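/- Let Λ be a lattice in ℂ and z₁, z₂ ∈ ℂ \ Λ. Then ℘(z₁; Λ) = ℘(z₂; Λ) if and only if z₁ ≡ z₂ (mod Λ) or z₁ ≡ -z₂ (mod Λ), where ℘ is the Weierstrass ℘-function relative to Λ. -/

import Mathlib

open Complex

/-- The Weierstrass ℘-function relative to a subgroup `Λ` of `ℂ`. -/
noncomputable def weierstrassP (Λ : AddSubgroup ℂ) (z : ℂ) : ℂ :=
  1 / z ^ 2 + ∑' ω : {ω : Λ // (ω : ℂ) ≠ 0}, (1 / (z - (ω : ℂ)) ^ 2 - 1 / (ω : ℂ) ^ 2)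

/-- `Λ` is a lattice in `ℂ`: it is generated by two ℝ-linearly independent periods. -/
def IsLattice (Λ : AddSubgroup ℂ) : Prop :=
  ∃ ω₁ ω₂ : ℂ, ω₂ ≠ 0 ∧ (ω₁ / ω₂).im ≠ 0 ∧ Λ = AddSubgroup.closure {ω₁, ω₂}

open Filter Topology

namespace WPAux

lemma eq_of_eventuallyEq {H A B : ℂ → ℂ} {z : ℂ} (hA : ContinuousAt A z) (hB : ContinuousAt B z)
    (h1 : H =ᶠ[𝓝[≠] z] A) (h2 : H =ᶠ[𝓝[≠] z] B) : A z = B z := by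
  have hA' : Tendsto A (𝓝[≠] z) (𝓝 (A z)) := hA.tendsto.mono_left nhdsWithin_le_nhds
  have hB' : Tendsto B (𝓝[≠] z) (𝓝 (B z)) := hB.tendsto.mono_left nhdsWithin_le_nhds
  exact tendsto_nhds_unique (hA'.congr' h1.symm) (hB'.congr' h2.symm)

lemma tendsto_shift (z l : ℂ) : Tendsto (fun w => w + l) (𝓝[≠] z) (𝓝[≠] (z + l)) := by
  refine tendsto_nhdsWithin_iff.2 ⟨?_, ?_⟩
  · exact (Continuous.tendsto (by fun_prop) z).mono_left nhdsWithin_le_nhds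
  · filter_upwards [self_mem_nhdsWithin] with w hw
    simpa using hw

lemma liouville (L : PeriodPair) (H : ℂ → ℂ) (hm : ∀ z, MeromorphicAt H z)
    (hp : ∀ z, ∀ l ∈ L.lattice, H (z + l) = H z) (ho : ∀ z, 0 ≤ meromorphicOrderAt H z) :
    ∃ K, ∀ z, ∀ᶠ w in 𝓝[≠] z, H w = K := by
  choose G hG hHG using fun z => (hm z).meromorphicOrderAt_nonneg_iff.1 (ho z)
  have key : ∀ z, (fun w => G w w) =ᶠ[𝓝 z] G z := by
    intro z
    have h1 : ∀ᶠ w in 𝓝[≠] z, G w w = G z w := by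
      have e1 := eventually_eventually_nhdsWithin.2 (hHG z)
      have e2 : ∀ᶠ w in 𝓝[≠] z, AnalyticAt ℂ (G z) w :=
        (hG z).eventually_analyticAt.filter_mono nhdsWithin_le_nhds
      filter_upwards [e1, e2, self_mem_nhdsWithin] with w h1 h2 h3
      refine eq_of_eventuallyEq (hG w).continuousAt h2.continuousAt (hHG w) ?_
      have hs : 𝓝[≠] w ≤ 𝓝[{z}ᶜ] w := by
        rw [isOpen_compl_singleton.nhdsWithin_eq h3]
        exact nhdsWithin_le_nhds
      exact h1.filter_mono hs
    rw [eventually_nhdsWithin_iff] at h1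
    filter_upwards [h1] with w hw
    by_cases hwz : w = z
    · rw [hwz]
    · exact hw hwz
  have hd : Differentiable ℂ (fun w => G w w) := fun z =>
    ((hG z).congr (key z).symm).differentiableAt
  have hper : ∀ z w, w ∈ L.lattice → G (z + w) (z + w) = G z z := by
    intro z l hl
    refine eq_of_eventuallyEq (H := H) (z := z) (A := fun w => G (z + l) (w + l)) ?_
      (hG z).continuousAt ?_ (hHG z)
    · exact ContinuousAt.comp (f := fun w => w + l) (hG (z + l)).continuousAt (by fun_prop)
    · filter_upwards [(tendsto_shift z l).eventually (hHG (z + l))] with w hw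
      rw [← hw, hp w l hl]
  refine ⟨G 0 0, fun z => ?_⟩
  filter_upwards [hHG z, (key z).filter_mono nhdsWithin_le_nhds] with w h1 h2
  rw [h1, ← h2]
  exact hd.apply_eq_apply_of_bounded (IsZLattice.isCompact_range_of_periodic L.lattice _
    hd.continuous hper).isBounded w 0

lemma order_ne_odd (F : ℂ → ℂ) (x : ℂ) (n : ℤ) (hn : Odd n)
    (hF : MeromorphicAt F x) (he : ∀ z, F (2 * x - z) = F z) :
    meromorphicOrderAt F x ≠ (n : WithTop ℤ) := by
  intro h
  obtain ⟨g, hg, hg0, hFg⟩ := (meromorphicOrderAt_eq_int_iff hF).1 h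
  have ht : Tendsto (fun w => 2 * x - w) (𝓝[≠] x) (𝓝[≠] x) := by
    refine tendsto_nhdsWithin_iff.2 ⟨?_, ?_⟩
    · have : Tendsto (fun w => 2 * x - w) (𝓝 x) (𝓝 (2 * x - x)) :=
        Continuous.tendsto (by fun_prop) x
      rw [show 2 * x - x = x by ring] at this
      exact this.mono_left nhdsWithin_le_nhds
    · filter_upwards [self_mem_nhdsWithin] with w hw hw'
      apply hw
      simp only [Set.mem_singleton_iff] at hw' ⊢
      linear_combination -hw'
  have h2 : ∀ᶠ w in 𝓝[≠] x, g w = - g (2 * x - w) := by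
    filter_upwards [hFg, ht.eventually hFg, self_mem_nhdsWithin] with w h1 h2 h3
    have h3' : w - x ≠ 0 := sub_ne_zero.2 h3
    rw [he, h1, show 2 * x - w - x = -(w - x) by ring, hn.neg_zpow] at h2
    simp only [smul_eq_mul] at h2
    have : (w - x) ^ n ≠ 0 := zpow_ne_zero _ h3'
    apply mul_left_cancel₀ this
    linear_combination h2
  have t1 : Tendsto g (𝓝[≠] x) (𝓝 (g x)) :=
    hg.continuousAt.tendsto.mono_left nhdsWithin_le_nhds
  have t2 : Tendsto g (𝓝[≠] x) (𝓝 (-g x)) := by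
    refine Tendsto.congr' (h2.mono fun w hw => hw.symm) ?_
    exact (t1.comp ht).neg
  exact hg0 (CharZero.eq_neg_self_iff.1 (tendsto_nhds_unique t1 t2))

section
variable (L : PeriodPair) (c : ℂ)

/-- The function `℘ - c`. -/
noncomputable def f (z : ℂ) : ℂ := L.weierstrassP z - c

lemma f_mero (z : ℂ) : MeromorphicAt (f L c) z :=
  (L.meromorphic_weierstrassP z).sub (.const c z)

lemma f_neg (z : ℂ) : f L c (-z) = f L c z := by simp [f, L.weierstrassP_neg]

lemma f_add (z l : ℂ) (hl : l ∈ L.lattice) : f L c (z + l) = f L c z := by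
  simp [f, L.weierstrassP_add_coe z ⟨l, hl⟩]

lemma f_analytic {z : ℂ} (hz : z ∉ L.lattice) : AnalyticAt ℂ (f L c) z :=
  (L.analyticOnNhd_weierstrassP z hz).sub analyticAt_const

lemma ord_f_lattice {z : ℂ} (hz : z ∈ L.lattice) : meromorphicOrderAt (f L c) z = (-2 : ℤ) := by
  have h := L.order_weierstrassP z hz
  have h2 : (0 : WithTop ℤ) ≤ meromorphicOrderAt (fun _ : ℂ => -c) z :=
    analyticAt_const.meromorphicOrderAt_nonneg
  have h3 : f L c = L.weierstrassP + fun _ => -c := by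
    ext w; simp [f, sub_eq_add_neg]
  rw [h3, meromorphicOrderAt_add_eq_left_of_lt (.const _ _), h]
  · rfl
  · rw [h]; exact lt_of_lt_of_le (by decide) h2

lemma ord_f_nonneg {z : ℂ} (hz : z ∉ L.lattice) : 0 ≤ meromorphicOrderAt (f L c) z :=
  (f_analytic L c hz).meromorphicOrderAt_nonneg

lemma ord_f_ne_top (z : ℂ) : meromorphicOrderAt (f L c) z ≠ ⊤ := by
  refine MeromorphicOn.meromorphicOrderAt_ne_top_of_isPreconnected (U := Set.univ) (x := 0)
    (fun z _ => f_mero L c z) isPreconnected_univ trivial trivial ?_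
  rw [ord_f_lattice L c L.lattice.zero_mem]
  exact WithTop.coe_ne_top

lemma f_ne_zero (z : ℂ) : ∀ᶠ w in 𝓝[≠] z, f L c w ≠ 0 :=
  (meromorphicOrderAt_ne_top_iff_eventually_ne_zero (f_mero L c z)).1 (ord_f_ne_top L c z)

lemma f_add_ne_zero (z a : ℂ) : ∀ᶠ w in 𝓝[≠] z, f L c (w + a) ≠ 0 :=
  (tendsto_shift z a).eventually (f_ne_zero L c (z + a))

lemma ord_f_int (z : ℂ) : ∃ n : ℤ, meromorphicOrderAt (f L c) z = n :=
  ⟨_, (WithTop.coe_untop₀_of_ne_top (ord_f_ne_top L c z)).symm⟩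

/-- The order of `℘ - c` as an integer. -/
noncomputable def o (z : ℂ) : ℤ := (ord_f_int L c z).choose

lemma o_spec (z : ℂ) : meromorphicOrderAt (f L c) z = o L c z := (ord_f_int L c z).choose_spec

lemma o_lattice {z : ℂ} (hz : z ∈ L.lattice) : o L c z = -2 := by
  have := o_spec L c z
  rw [ord_f_lattice L c hz] at this
  exact_mod_cast this.symm

lemma o_nonneg {z : ℂ} (hz : z ∉ L.lattice) : 0 ≤ o L c z := by
  have := ord_f_nonneg L c hz
  rw [o_spec] at this
  exact_mod_cast this

lemma o_pos {z : ℂ} (hz : z ∉ L.lattice) (h0 : f L c z = 0) : 1 ≤ o L c z := by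
  have h1 : Tendsto (f L c) (𝓝[≠] z) (𝓝 0) := by
    rw [← h0]
    exact (f_analytic L c hz).continuousAt.tendsto.mono_left nhdsWithin_le_nhds
  have := (tendsto_zero_iff_meromorphicOrderAt_pos (f_mero L c z)).1 h1
  rw [o_spec] at this
  have h2 : 0 < o L c z := by exact_mod_cast this
  omega

lemma o_two {z : ℂ} (hz : z ∉ L.lattice) (h2 : 2 * z ∈ L.lattice) (h0 : f L c z = 0) :
    2 ≤ o L c z := by
  have h1 := o_pos L c hz h0
  have h3 : o L c z ≠ 1 := by
    intro h
    refine order_ne_odd (f L c) z 1 odd_one (f_mero L c z) ?_ (by rw [o_spec, h])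
    intro w
    rw [sub_eq_neg_add, f_add L c _ _ h2, f_neg]
  omega

lemma f_shift_mero (a z : ℂ) : MeromorphicAt (fun w => f L c (w + a)) z :=
  MeromorphicAt.comp_analyticAt (g := fun w => w + a) (f_mero L c (z + a)) (by fun_prop)

lemma ord_shift (a z : ℂ) :
    meromorphicOrderAt (fun w => f L c (w + a)) z = o L c (z + a) := by
  rw [← o_spec]
  exact meromorphicOrderAt_comp_add_const_eq_meromorphicOrderAt (f := f L c)

lemma f_shift_cont {a z : ℂ} (h : z + a ∉ L.lattice) : ContinuousAt (fun w => f L c (w + a)) z :=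
  ContinuousAt.comp (f := fun w => w + a) (f_analytic L c h).continuousAt (by fun_prop)

/-- First case: `a` is a two-torsion point. -/
lemma case_one {a b : ℂ} (ha : a ∉ L.lattice) (hb : b ∉ L.lattice) (h2 : 2 * a ∈ L.lattice)
    (fa : f L c a = 0) (fb : f L c b = 0) (hab : b + a ∉ L.lattice) : False := by
  have oa : ∀ z, z + a ∈ L.lattice → 2 ≤ o L c z := by
    intro z hz
    have hz' : f L c z = 0 := by
      have := f_add L c (-a) _ hz
      rw [f_neg, fa] at this
      simpa using this
    refine o_two L c (fun h => ha ?_) ?_ hz'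
    · simpa using L.lattice.sub_mem hz h
    · have := L.lattice.sub_mem (L.lattice.add_mem hz hz) h2
      convert this using 1; ring
  obtain ⟨K, hK⟩ := liouville L ((f L c) * (fun w => f L c (w + a)))
    (fun z => (f_mero L c z).mul (f_shift_mero L c a z))
    (fun z l hl => by
      simp only [Pi.mul_apply]
      rw [f_add L c z l hl, show z + l + a = z + a + l by ring, f_add L c _ l hl])
    (fun z => by
      rw [meromorphicOrderAt_mul (f_mero L c z) (f_shift_mero L c a z), o_spec, ord_shift]
      suffices 0 ≤ o L c z + o L c (z + a) by exact_mod_cast this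
      by_cases hz : z ∈ L.lattice
      · have h1 := o_lattice L c hz
        have h3 := oa (z + a) (by
          have := L.lattice.add_mem hz h2
          convert this using 1; ring)
        omega
      · by_cases hz' : z + a ∈ L.lattice
        · have h1 := o_lattice L c hz'
          have h3 := oa z hz'
          omega
        · have h1 := o_nonneg L c hz
          have h3 := o_nonneg L c hz'
          omega)
  have hK0 : f L c b * f L c (b + a) = K :=
    eq_of_eventuallyEq (z := b) (H := (f L c) * (fun w => f L c (w + a)))
      (A := fun w => f L c w * f L c (w + a)) (B := fun _ => K)
      ((f_analytic L c hb).continuousAt.mul (f_shift_cont L c hab)) continuousAt_const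
      (Eventually.of_forall fun _ => rfl) (hK b)
  rw [fb, zero_mul] at hK0
  obtain ⟨w, h1, h3, h4⟩ := ((hK b).and ((f_ne_zero L c b).and (f_add_ne_zero L c b a))).exists
  rw [← hK0] at h1
  exact mul_ne_zero h3 h4 h1

/-- Second case: `a` is not a two-torsion point. -/
lemma case_two {a b : ℂ} (ha : a ∉ L.lattice) (hb : b ∉ L.lattice) (h2 : 2 * a ∉ L.lattice)
    (fa : f L c a = 0) (fb : f L c b = 0) (hab : b + a ∉ L.lattice) (hab' : b + -a ∉ L.lattice) :
    False := by
  have ha' : -a ∉ L.lattice := fun h => ha (by simpa using L.lattice.neg_mem h)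
  have fa' : f L c (-a) = 0 := by rw [f_neg, fa]
  have oa : ∀ x z, x ∉ L.lattice → f L c x = 0 → z - x ∈ L.lattice → 1 ≤ o L c z := by
    intro x z hx fx hz
    have hz' : f L c z = 0 := by
      have := f_add L c x _ hz
      rw [fx] at this
      simpa using this
    refine o_pos L c (fun h => hx ?_) hz'
    simpa using L.lattice.sub_mem h hz
  set p : ℂ → ℂ := fun w => f L c (w + a) with hp
  set q : ℂ → ℂ := fun w => f L c (w + -a) with hq
  set H : ℂ → ℂ := f L c * f L c * (p * q) with hH
  have pm := f_shift_mero L c a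
  have qm := f_shift_mero L c (-a)
  have fm := f_mero L c
  have Hm : ∀ z, MeromorphicAt H z := fun z => ((fm z).mul (fm z)).mul ((pm z).mul (qm z))
  have Hord : ∀ z, meromorphicOrderAt H z =
      ((o L c z + o L c z + (o L c (z + a) + o L c (z + -a)) : ℤ) : WithTop ℤ) := by
    intro z
    rw [hH, meromorphicOrderAt_mul ((fm z).mul (fm z)) ((pm z).mul (qm z)),
      meromorphicOrderAt_mul (fm z) (fm z), meromorphicOrderAt_mul (pm z) (qm z),
      o_spec, ord_shift, ord_shift]
    push_cast
    rfl
  have Hper : ∀ z, ∀ l ∈ L.lattice, H (z + l) = H z := by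
    intro z l hl
    simp only [hH, hp, hq, Pi.mul_apply]
    rw [f_add L c z l hl, show z + l + a = z + a + l by ring, f_add L c _ l hl,
      show z + l + -a = z + -a + l by ring, f_add L c _ l hl]
  have Heven : ∀ z, H (-z) = H z := by
    intro z
    simp only [hH, hp, hq, Pi.mul_apply]
    rw [f_neg, show -z + a = -(z + -a) by ring, show -z + -a = -(z + a) by ring, f_neg, f_neg]
    ring
  have Hoff : ∀ z, z ∉ L.lattice → 0 ≤ meromorphicOrderAt H z := by
    intro z hz
    rw [Hord]
    suffices 0 ≤ o L c z + o L c z + (o L c (z + a) + o L c (z + -a)) by exact_mod_cast this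
    have h0 := o_nonneg L c hz
    by_cases h3 : z + a ∈ L.lattice
    · have h5 := oa (-a) z ha' fa' (by simpa using h3)
      have h4 : z + -a ∉ L.lattice := by
        intro h4
        apply h2
        have := L.lattice.sub_mem h3 h4
        convert this using 1; ring
      have h6 := o_lattice L c h3
      have h7 := o_nonneg L c h4
      omega
    · have h7 := o_nonneg L c h3
      by_cases h4 : z + -a ∈ L.lattice
      · have h5 := oa a z ha fa (by simpa [sub_eq_add_neg] using h4)
        have h6 := o_lattice L c h4
        omega
      · have h8 := o_nonneg L c h4
        omega
  have hz0 : (0 : ℂ) ∈ L.lattice := L.lattice.zero_mem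
  -- multiply by `z ^ 2`
  have sqm : MeromorphicAt (fun z : ℂ => z ^ 2) 0 := by fun_prop
  have sqo : meromorphicOrderAt (fun z : ℂ => z ^ 2) 0 = ((2 : ℤ) : WithTop ℤ) := by
    rw [meromorphicOrderAt_eq_int_iff sqm]
    refine ⟨fun _ => 1, analyticAt_const, one_ne_zero, Eventually.of_forall fun z => ?_⟩
    simp only [sub_zero, smul_eq_mul, mul_one]
    norm_cast
  obtain ⟨A, hA⟩ : ∃ A, Tendsto ((fun z : ℂ => z ^ 2) * H) (𝓝[≠] 0) (𝓝 A) := by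
    refine tendsto_nhds_of_meromorphicOrderAt_nonneg (sqm.mul (Hm 0)) ?_
    rw [meromorphicOrderAt_mul sqm (Hm 0), sqo, Hord]
    suffices 0 ≤ 2 + (o L c 0 + o L c 0 + (o L c (0 + a) + o L c (0 + -a))) by exact_mod_cast this
    have h1 := o_lattice L c hz0
    have h3 := oa a (0 + a) ha fa (by simp)
    have h4 := oa (-a) (0 + -a) ha' fa' (by simp)
    omega
  obtain ⟨B, hB0, hB⟩ : ∃ B ≠ 0, Tendsto ((fun z : ℂ => z ^ 2) * f L c) (𝓝[≠] 0) (𝓝 B) := by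
    refine tendsto_ne_zero_of_meromorphicOrderAt_eq_zero (sqm.mul (fm 0)) ?_
    rw [meromorphicOrderAt_mul sqm (fm 0), sqo, ord_f_lattice L c hz0]
    rfl
  set α := A / B with hα
  set D : ℂ → ℂ := fun z => H z - α * f L c z with hD
  have Dm : ∀ z, MeromorphicAt D z := fun z => (Hm z).sub ((MeromorphicAt.const α z).mul (fm z))
  have Dper : ∀ z, ∀ l ∈ L.lattice, D (z + l) = D z := by
    intro z l hl
    simp only [hD]
    rw [Hper z l hl, f_add L c z l hl]
  have D0 : 0 ≤ meromorphicOrderAt D 0 := by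
    have h1 : Tendsto ((fun z : ℂ => z ^ 2) * D) (𝓝[≠] 0) (𝓝 0) := by
      have := hA.sub (hB.const_mul α)
      rw [hα, div_mul_cancel₀ _ hB0, sub_self] at this
      refine this.congr fun z => ?_
      simp only [hD, Pi.mul_apply, hα]
      ring
    have h3 := (tendsto_zero_iff_meromorphicOrderAt_pos (sqm.mul (Dm 0))).1 h1
    rw [meromorphicOrderAt_mul sqm (Dm 0), sqo] at h3
    have h4 := order_ne_odd D 0 (-1) (by decide) (Dm 0) (fun z => by
      simp only [hD]
      rw [mul_zero, zero_sub, Heven, f_neg])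
    cases h : meromorphicOrderAt D 0 with
    | top => exact le_top
    | coe n =>
      rw [h] at h3 h4
      have h3' : 0 < 2 + n := by exact_mod_cast h3
      have h4' : n ≠ -1 := by exact_mod_cast h4
      have : 0 ≤ n := by omega
      exact_mod_cast this
  have Dord : ∀ z, 0 ≤ meromorphicOrderAt D z := by
    intro z
    by_cases hz : z ∈ L.lattice
    · have h1 : D ∘ (· + z) = D := by
        ext w; exact Dper w z hz
      have h3 := meromorphicOrderAt_comp_add_const_eq_meromorphicOrderAt (f := D) (c := z) (x := 0)
      rw [h1, zero_add] at h3
      rw [← h3]; exact D0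
    · have h1 : D = H + fun z => (-α) * f L c z := by
        ext w; simp only [hD, Pi.add_apply]; ring
      rw [h1]
      refine le_trans (le_min (Hoff z hz) ?_)
        (meromorphicOrderAt_add (Hm z) ((MeromorphicAt.const _ z).mul (fm z)))
      exact (analyticAt_const.mul (f_analytic L c hz)).meromorphicOrderAt_nonneg
  obtain ⟨K, hK⟩ := liouville L D Dm Dper Dord
  have fc := (f_analytic L c hb).continuousAt
  have pc : ContinuousAt p b := f_shift_cont L c hab
  have qc : ContinuousAt q b := f_shift_cont L c hab'
  have hK0 : D b = K :=
    eq_of_eventuallyEq (z := b) (H := D) (A := D) (B := fun _ => K)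
      (((fc.mul fc).mul (pc.mul qc)).sub (continuousAt_const.mul fc)) continuousAt_const
      (Eventually.of_forall fun _ => rfl) (hK b)
  have hK1 : K = 0 := by
    rw [← hK0]; simp [hD, hH, fb]
  have hJ : ∀ᶠ w in 𝓝[≠] b, (f L c * (p * q)) w = α := by
    filter_upwards [hK b, f_ne_zero L c b] with w h1 h3
    rw [hK1] at h1
    apply mul_left_cancel₀ h3
    simp only [hD, hH, Pi.mul_apply] at h1 ⊢
    linear_combination h1
  have hα0 : (f L c * (p * q)) b = α :=
    eq_of_eventuallyEq (z := b) (H := f L c * (p * q)) (A := f L c * (p * q)) (B := fun _ => α)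
      (fc.mul (pc.mul qc)) continuousAt_const
      (Eventually.of_forall fun _ => rfl) hJ
  have hα1 : α = 0 := by
    rw [← hα0]; simp [fb]
  obtain ⟨w, h1, h3, h4, h5⟩ := (hJ.and ((f_ne_zero L c b).and
    ((f_add_ne_zero L c b a).and (f_add_ne_zero L c b (-a))))).exists
  rw [hα1] at h1
  exact mul_ne_zero h3 (mul_ne_zero h4 h5) h1

end

lemma main (L : PeriodPair) (a b : ℂ) (ha : a ∉ L.lattice) (hb : b ∉ L.lattice) :
    L.weierstrassP a = L.weierstrassP b ↔ (a - b ∈ L.lattice ∨ a + b ∈ L.lattice) := by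
  constructor
  · intro h
    by_contra! hc
    obtain ⟨h1, h2⟩ := hc
    have fa : f L (L.weierstrassP a) a = 0 := by simp [f]
    have fb : f L (L.weierstrassP a) b = 0 := by simp [f, h]
    have h3 : b + a ∉ L.lattice := by rwa [add_comm]
    by_cases h4 : 2 * a ∈ L.lattice
    · exact case_one L _ ha hb h4 fa fb h3
    · refine case_two L _ ha hb h4 fa fb h3 fun h5 => h1 ?_
      have := L.lattice.neg_mem h5
      convert this using 1; ring
  · rintro (h | h)
    · have := L.weierstrassP_add_coe b ⟨_, h⟩
      simpa using this
    · have := L.weierstrassP_add_coe (-b) ⟨_, h⟩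
      rw [L.weierstrassP_neg] at this
      simpa using this

lemma exists_pair (Λ : AddSubgroup ℂ) (hΛ : IsLattice Λ) :
    ∃ L : PeriodPair, ∀ z, z ∈ L.lattice ↔ z ∈ Λ := by
  obtain ⟨x, y, hy, hxy, rfl⟩ := hΛ
  refine ⟨⟨x, y, ?_⟩, fun z => ?_⟩
  · rw [LinearIndependent.pair_iff]
    intro s t hst
    have h1 : (s : ℂ) * (x / y) + t = 0 := by
      simp only [real_smul] at hst
      field_simp
      linear_combination hst
    have h2 := congrArg Complex.im h1
    have h3 := congrArg Complex.re h1
    simp only [add_im, im_ofReal_mul, ofReal_im, add_zero, zero_im,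
      mul_eq_zero, hxy, or_false] at h2
    subst h2
    simpa using h3
  · rw [PeriodPair.mem_lattice, AddSubgroup.mem_closure_pair]
    simp

lemma wp_eq (Λ : AddSubgroup ℂ) (L : PeriodPair) (hL : ∀ z, z ∈ L.lattice ↔ z ∈ Λ) (z : ℂ) :
    _root_.weierstrassP Λ z = L.weierstrassP z := by
  have h0 := L.weierstrassPExcept_add 0 z
  rw [_root_.weierstrassP, ← h0]
  simp only [ZeroMemClass.coe_zero, sub_zero]
  have : (∑' ω : {ω : Λ // (ω : ℂ) ≠ 0}, (1 / (z - (ω : ℂ)) ^ 2 - 1 / (ω : ℂ) ^ 2)) =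
      L.weierstrassPExcept 0 z := by
    rw [PeriodPair.weierstrassPExcept]
    let e : L.lattice ≃ Λ := Equiv.subtypeEquivRight hL
    rw [← e.symm.tsum_eq]
    rw [← tsum_subtype_eq_of_support_subset (s := {ω : Λ | (ω : ℂ) ≠ 0})]
    · apply tsum_congr
      rintro ⟨ω, hω⟩
      have h1 : ((e.symm ω : L.lattice) : ℂ) = ω := rfl
      rw [h1, if_neg hω]
    · intro ω hω h
      apply hω
      have h1 : ((e.symm ω : L.lattice) : ℂ) = ω := rfl
      exact if_pos (h1.trans h)
  rw [this]
  ring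

end WPAux

theorem weierstrassP_eq_iff (Λ : AddSubgroup ℂ) (hΛ : IsLattice Λ)
    (z₁ z₂ : ℂ) (h₁ : z₁ ∉ Λ) (h₂ : z₂ ∉ Λ) :
    weierstrassP Λ z₁ = weierstrassP Λ z₂ ↔ (z₁ - z₂ ∈ Λ ∨ z₁ + z₂ ∈ Λ) := by
  obtain ⟨L, hL⟩ := WPAux.exists_pair Λ hΛ
  rw [WPAux.wp_eq Λ L hL, WPAux.wp_eq Λ L hL, ← hL, ← hL]
  exact WPAux.main L z₁ z₂ (by rwa [hL]) (by rwa [hL])
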